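/- A safe finite structure with k distinguished elements has a finite frontier with respect to the class of all finite structures (over the same schema, with k distinguished elements) if and only if it has a finite frontier with respect to the class of all safe finite structures. -/

import Mathlib

/-- A finite relational structure over a schema `S` (with arity function `ar`)
with `k` distinguished elements. -/
structure PStruct (S : Type) (ar : S → ℕ) (k : ℕ) : Type 1 where
  dom : Type
  finite : Finite dom
  facts : ∀ R : S, Set (Fin (ar R) → dom)
  dist : Fin k → dom

attribute [instance] PStruct.finite

namespace PStruct

variable {S : Type} {ar : S → ℕ} {k : ℕ}

/-- `h` is a homomorphism from `A` to `B`: it preserves all facts and maps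
distinguished elements to corresponding distinguished elements. -/
def IsHom (A B : PStruct S ar k) (h : A.dom → B.dom) : Prop :=
  (∀ (R : S) (t : Fin (ar R) → A.dom), t ∈ A.facts R → (fun i => h (t i)) ∈ B.facts R) ∧
  ∀ i : Fin k, h (A.dist i) = B.dist i

/-- `(A,𝐚) → (B,𝐛)`: a homomorphism exists. -/
def HomTo (A B : PStruct S ar k) : Prop := ∃ h, IsHom A B h

/-- Homomorphic equivalence. -/
def HomEquiv (A B : PStruct S ar k) : Prop := HomTo A B ∧ HomTo B A

/-- Direct product of two structures with distinguished elements. -/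
def prod (A B : PStruct S ar k) : PStruct S ar k where
  dom := A.dom × B.dom
  finite := inferInstance
  facts R := {t | (fun i => (t i).1) ∈ A.facts R ∧ (fun i => (t i).2) ∈ B.facts R}
  dist i := (A.dist i, B.dist i)

/-- The facts of a structure, as a type. -/
def Fact (A : PStruct S ar k) : Type := Σ R : S, {t : Fin (ar R) → A.dom // t ∈ A.facts R}

/-- Occurrences of elements in facts: a fact together with a position in it. -/
def Occ (A : PStruct S ar k) : Type :=
  Σ R : S, {t : Fin (ar R) → A.dom // t ∈ A.facts R} × Fin (ar R)

def Occ.fact {A : PStruct S ar k} (o : Occ A) : Fact A := ⟨o.1, o.2.1⟩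

def Occ.elem {A : PStruct S ar k} (o : Occ A) : A.dom := o.2.1.1 o.2.2

/-- Vertices of the (subdivided) incidence graph: elements, occurrences, and facts.
Each occurrence vertex subdivides one edge of the bipartite incidence multigraph,
so that cycles (resp. connectivity) of the incidence multigraph correspond exactly to
cycles (resp. connectivity) of this simple graph. -/
def IncV (A : PStruct S ar k) : Type := A.dom ⊕ (Occ A ⊕ Fact A)

/-- The incidence graph of a structure, as a simple graph (with each
element-occurrence-in-a-fact edge of the incidence multigraph subdivided). -/
def incGraph (A : PStruct S ar k) : SimpleGraph (IncV A) where
  Adj v w := ∃ o : Occ A,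
    (v = Sum.inl o.elem ∧ w = Sum.inr (Sum.inl o)) ∨
    (w = Sum.inl o.elem ∧ v = Sum.inr (Sum.inl o)) ∨
    (v = Sum.inr (Sum.inl o) ∧ w = Sum.inr (Sum.inr o.fact)) ∨
    (w = Sum.inr (Sum.inl o) ∧ v = Sum.inr (Sum.inr o.fact))
  symm := by
    constructor
    rintro v w ⟨o, h⟩
    exact ⟨o, by tauto⟩
  loopless := by
    constructor
    rintro v ⟨o, (⟨h1, h2⟩ | ⟨h1, h2⟩ | ⟨h1, h2⟩ | ⟨h1, h2⟩)⟩ <;> rw [h1] at h2 <;>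
      first
      | exact Sum.inl_ne_inr h2
      | exact Sum.inl_ne_inr (Sum.inr_injective h2)

/-- A structure is acyclic if its incidence graph is acyclic (Berge acyclicity). -/
def Acyclic (A : PStruct S ar k) : Prop := (incGraph A).IsAcyclic

/-- A structure is c-acyclic if every cycle of its incidence graph passes through
a distinguished element. -/
def CAcyclic (A : PStruct S ar k) : Prop :=
  ∀ (v : IncV A) (c : (incGraph A).Walk v v), c.IsCycle →
    ∃ i : Fin k, Sum.inl (A.dist i) ∈ c.support

/-- A structure is c-connected if every connected component of its incidence graph
contains a distinguished element. -/
def CConnected (A : PStruct S ar k) : Prop :=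
  ∀ v : IncV A, ∃ i : Fin k, (incGraph A).Reachable (Sum.inl (A.dist i)) v

/-- The incidence graph is connected. -/
def IncConnected (A : PStruct S ar k) : Prop := (incGraph A).Connected

/-- The fact graph: vertices are facts, with an edge between distinct facts that
share a non-distinguished element. -/
def factGraph (A : PStruct S ar k) : SimpleGraph (Fact A) where
  Adj f g := f ≠ g ∧ ∃ b : A.dom, (∀ i, b ≠ A.dist i) ∧ (∃ j, f.2.1 j = b) ∧ (∃ j, g.2.1 j = b)
  symm := by
    constructor
    rintro f g ⟨hne, b, h1, h2, h3⟩
    exact ⟨hne.symm, b, h1, h3, h2⟩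
  loopless := by constructor; rintro f ⟨hne, -⟩; exact hne rfl

/-- A structure is fg-connected if its fact graph is connected. -/
def FgConnected (A : PStruct S ar k) : Prop := (factGraph A).Connected

/-- A structure is a core if it admits no homomorphism to a proper substructure,
i.e. every endomorphism is surjective on elements and on facts. -/
def IsCore (A : PStruct S ar k) : Prop :=
  ∀ h : A.dom → A.dom, IsHom A A h →
    Function.Surjective h ∧
    ∀ (R : S) (t : Fin (ar R) → A.dom), t ∈ A.facts R →
      ∃ s ∈ A.facts R, (fun i => h (s i)) = t

/-- Unique Names Property: the distinguished elements are pairwise distinct. -/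
def UNP (A : PStruct S ar k) : Prop := Function.Injective A.dist

/-- A structure is safe if every distinguished element occurs in at least one fact. -/
def Safe (A : PStruct S ar k) : Prop :=
  ∀ i : Fin k, ∃ (R : S) (t : Fin (ar R) → A.dom), t ∈ A.facts R ∧ ∃ j, t j = A.dist i

/-- A structure is (the canonical structure of) a conjunctive query iff every element
occurs in at least one fact (in particular it is safe). -/
def IsCQ (A : PStruct S ar k) : Prop :=
  ∀ x : A.dom, ∃ (R : S) (t : Fin (ar R) → A.dom), t ∈ A.facts R ∧ ∃ j, t j = x

/-- The size of a structure: its number of facts. -/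
noncomputable def size (A : PStruct S ar k) : ℕ := Nat.card (Fact A)

/-- The total size of a set of structures: the sum of (size + 1) over its members. -/
noncomputable def totalSize (F : Set (PStruct S ar k)) : ℕ := ∑ᶠ B ∈ F, (size B + 1)

/-- `F` is a frontier for `A` with respect to the class `C`. -/
def IsFrontier (C : Set (PStruct S ar k)) (A : PStruct S ar k)
    (F : Set (PStruct S ar k)) : Prop :=
  F.Finite ∧
  (∀ B ∈ F, HomTo B A) ∧
  (∀ B ∈ F, ¬ HomTo A B) ∧
  ∀ C' ∈ C, HomTo C' A → ¬ HomTo A C' → ∃ B ∈ F, HomTo C' B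

/-- `D` is a finite duality for `A` with respect to the class `C`. -/
def IsDuality (C : Set (PStruct S ar k)) (A : PStruct S ar k)
    (D : Set (PStruct S ar k)) : Prop :=
  D.Finite ∧ ∀ C' ∈ C, (HomTo A C' ↔ ∀ B ∈ D, ¬ HomTo C' B)

/-- A conjunctive query (given by its canonical structure `Q`) fits the example sets
`(E⁺, E⁻)`: every example in `E⁺` is positive and every example in `E⁻` is negative.
(By Chandra–Merlin, `(A,𝐚)` is a positive example for `Q` iff `Q → (A,𝐚)`.) -/
def Fits (Q : PStruct S ar k) (Ep Em : Set (PStruct S ar k)) : Prop :=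
  (∀ E ∈ Ep, HomTo Q E) ∧ (∀ E ∈ Em, ¬ HomTo Q E)

/-- `(E⁺, E⁻)` uniquely characterizes the CQ `Q` with respect to the class `C` of CQs
(all represented by their canonical structures): `Q` fits, and every member of `C`
that fits is logically equivalent (i.e. homomorphically equivalent) to `Q`. -/
def UniquelyCharacterizes (Ep Em : Set (PStruct S ar k)) (Q : PStruct S ar k)
    (C : Set (PStruct S ar k)) : Prop :=
  Fits Q Ep Em ∧ ∀ Q' ∈ C, Fits Q' Ep Em → HomEquiv Q Q'

end PStruct

open PStruct

open Classical in
/-- `A` plus a fresh isolated element, which names the distinguished positions in `I`. -/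
noncomputable def addIsolated {S : Type} {ar : S → ℕ} {k : ℕ} (A : PStruct S ar k)
    (I : Set (Fin k)) : PStruct S ar k where
  dom := Option A.dom
  finite := inferInstance
  facts R := {t | ∃ s ∈ A.facts R, t = fun i => some (s i)}
  dist j := if j ∈ I then none else some (A.dist j)

/-- A safe structure has a finite frontier w.r.t. the class of all finite structures iff
it has a finite frontier w.r.t. the class of all safe finite structures. -/
theorem stmt_11 {S : Type} {ar : S → ℕ} {k : ℕ} (A : PStruct S ar k) (hA : Safe A) :
    (∃ F, IsFrontier Set.univ A F) ↔
      ∃ F, IsFrontier {B : PStruct S ar k | Safe B} A F := by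
  classical
  constructor
  · rintro ⟨F, h1, h2, h3, h4⟩
    exact ⟨F, h1, h2, h3, fun C _ => h4 C trivial⟩
  · rintro ⟨F, h1, h2, h3, h4⟩
    refine ⟨F ∪ {B | B ∈ Set.range (addIsolated A) ∧ HomTo B A ∧ ¬ HomTo A B}, ?_, ?_, ?_, ?_⟩
    · exact h1.union ((Set.finite_range _).subset fun B hB => hB.1)
    · rintro B (hB | hB)
      · exact h2 B hB
      · exact hB.2.1
    · rintro B (hB | hB)
      · exact h3 B hB
      · exact hB.2.2
    · intro C _ hCA hAC
      by_cases hC : Safe C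
      · obtain ⟨B, hB, h⟩ := h4 C hC hCA hAC
        exact ⟨B, Or.inl hB, h⟩
      · unfold Safe at hC
        push Not at hC
        obtain ⟨i, hi⟩ := hC
        obtain ⟨h, hf, hd⟩ := hCA
        refine ⟨addIsolated A {j | C.dist j = C.dist i}, Or.inr ⟨⟨_, rfl⟩, ?_, ?_⟩, ?_⟩
        · refine ⟨fun x : Option A.dom => x.getD (A.dist i), ?_, ?_⟩
          · rintro R t ⟨s, hs, rfl⟩
            exact hs
          · intro j
            by_cases hj : C.dist j = C.dist i
            · have : A.dist i = A.dist j := by rw [← hd, ← hd, hj]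
              simp [addIsolated, hj, this]
            · simp [addIsolated, hj]
        · rintro ⟨g, gf, gd⟩
          obtain ⟨R, t, ht, j, hj⟩ := hA i
          obtain ⟨s, hs, he⟩ := gf R t ht
          have e1 := congrFun he j
          have e2 := gd i
          simp only [hj, e2] at e1
          simp [addIsolated] at e1
        · refine ⟨fun x => if x = C.dist i then (none : Option A.dom) else some (h x), ?_, ?_⟩
          · intro R t ht
            refine ⟨_, hf R t ht, ?_⟩
            funext j
            exact if_neg (hi R t ht j)
          · intro j
            by_cases hj : C.dist j = C.dist i
            · simp [addIsolated, hj]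
            · simp [addIsolated, hj, hd]
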